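/- arXiv:2202.12765 — 3 statements merged into one kernel-verified Lean document; each statement's English description precedes it below -/
import Mathlib

section
/- The integral operator Q on L²(ℝ³) defined by (Qψ)(p) = ∫_{ℝ³} ψ(k) / (√|p| (|p|² + |k|²) √|k|) dk is bounded, with operator norm equal to 2π². -/
open MeasureTheory Real

namespace QOp

abbrev E := EuclideanSpace ℝ (Fin 3)

lemma radial (f : ℝ → ℝ) :
    ∫ x : E, f ‖x‖ = 4 * π * ∫ y in Set.Ioi (0:ℝ), y ^ 2 * f y := by
  rw [integral_fun_norm_addHaar]
  have h : (volume : Measure E).real (Metric.ball 0 1) = π * 4 / 3 := by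
    rw [Measure.real, EuclideanSpace.volume_ball_fin_three]
    simp [pi_nonneg, div_nonneg]
  rw [h]
  simp only [finrank_euclideanSpace, Fintype.card_fin, smul_eq_mul, nsmul_eq_mul]
  push_cast
  ring

lemma radial_integrable (f : ℝ → ℝ)
    (h : IntegrableOn (fun y : ℝ => y ^ 2 * f y) (Set.Ioi 0)) :
    Integrable (fun x : E => f ‖x‖) := by
  rw [integrable_fun_norm_addHaar]
  simpa using h

lemma hasDerivAt_aux {c : ℝ} (hc : 0 < c) (x : ℝ) :
    HasDerivAt (fun x => c⁻¹ * arctan (x / c)) (1 / (x ^ 2 + c ^ 2)) x := by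
  have := (((hasDerivAt_id x).div_const c).arctan).const_mul c⁻¹
  have e : c⁻¹ * (1 / (1 + (x / c) ^ 2) * (1 / c)) = 1 / (x ^ 2 + c ^ 2) := by
    field_simp
    ring
  rw [← e]
  exact this

lemma tendsto_aux {c : ℝ} (hc : 0 < c) :
    Filter.Tendsto (fun x => c⁻¹ * arctan (x / c)) Filter.atTop (nhds (c⁻¹ * (π / 2))) := by
  have h1 : Filter.Tendsto arctan Filter.atTop (nhds (π/2)) :=
    tendsto_nhds_of_tendsto_nhdsWithin tendsto_arctan_atTop
  exact (h1.comp (Filter.tendsto_id.atTop_div_const hc)).const_mul _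

lemma oneD_integrable {c : ℝ} (hc : 0 < c) :
    IntegrableOn (fun y : ℝ => 1 / (y ^ 2 + c ^ 2)) (Set.Ioi 0) :=
  integrableOn_Ioi_deriv_of_nonneg' (fun x _ => hasDerivAt_aux hc x)
    (fun x _ => by positivity) (tendsto_aux hc)

lemma oneD_integral {c : ℝ} (hc : 0 < c) :
    ∫ y in Set.Ioi (0:ℝ), 1 / (y ^ 2 + c ^ 2) = c⁻¹ * (π / 2) := by
  rw [integral_Ioi_of_hasDerivAt_of_nonneg' (fun x _ => hasDerivAt_aux hc x)
    (fun x _ => by positivity) (tendsto_aux hc)]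
  simp

lemma lint_J {c : ℝ} (hc : 0 < c) :
    ∫⁻ x : E, ENNReal.ofReal (1 / (‖x‖ ^ 2 * (‖x‖ ^ 2 + c ^ 2))) =
      ENNReal.ofReal (2 * π ^ 2 / c) := by
  have hcongr : Set.EqOn (fun y : ℝ => y ^ 2 * (1 / (y ^ 2 * (y ^ 2 + c ^ 2))))
      (fun y : ℝ => 1 / (y ^ 2 + c ^ 2)) (Set.Ioi 0) := by
    intro y hy
    have hy' : (0:ℝ) < y := hy
    simp only
    field_simp
  rw [← ofReal_integral_eq_lintegral_ofReal]
  · rw [radial (fun y => 1 / (y ^ 2 * (y ^ 2 + c ^ 2))),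
      setIntegral_congr_fun measurableSet_Ioi hcongr, oneD_integral hc]
    congr 1
    field_simp
    ring
  · apply radial_integrable (fun y => 1 / (y ^ 2 * (y ^ 2 + c ^ 2)))
    exact (integrableOn_congr_fun hcongr measurableSet_Ioi).2 (oneD_integrable hc)
  · exact Filter.Eventually.of_forall fun x => by positivity

/-- kernel -/
noncomputable def K (p k : E) : ℝ := 1 / (√‖p‖ * (‖p‖ ^ 2 + ‖k‖ ^ 2) * √‖k‖)
noncomputable def A (p k : E) : ℝ := 1 / (√‖p‖ * ((‖k‖ ^ 2) * (‖k‖ ^ 2 + ‖p‖ ^ 2)))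
noncomputable def B (p k : E) : ℝ := ‖k‖ / (√‖p‖ * (‖p‖ ^ 2 + ‖k‖ ^ 2))

lemma K_nonneg (p k : E) : 0 ≤ K p k := by unfold K; positivity
lemma A_nonneg (p k : E) : 0 ≤ A p k := by unfold A; positivity
lemma B_nonneg (p k : E) : 0 ≤ B p k := by unfold B; positivity

lemma K_eq (p k : E) : K p k = √(A p k) * √(B p k) := by
  rw [← Real.sqrt_mul (A_nonneg p k), eq_comm, Real.sqrt_eq_iff_mul_self_eq (mul_nonneg (A_nonneg p k) (B_nonneg p k)) (K_nonneg p k)]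
  rcases (norm_nonneg p).eq_or_lt with hp | hp
  · simp [K, A, B, ← hp]
  rcases (norm_nonneg k).eq_or_lt with hk | hk
  · simp [K, A, B, ← hk]
  unfold K A B
  field_simp
  rw [Real.sq_sqrt hk.le]
  ring

lemma K_meas : Measurable (fun z : E × E => K z.1 z.2) := by unfold K; fun_prop
lemma A_meas : Measurable (fun z : E × E => A z.1 z.2) := by unfold A; fun_prop
lemma B_meas : Measurable (fun z : E × E => B z.1 z.2) := by unfold B; fun_prop

lemma A_meas2 (p : E) : Measurable (fun k => A p k) := by unfold A; fun_prop
lemma B_meas2 (p : E) : Measurable (fun k => B p k) := by unfold B; fun_prop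
lemma B_meas1 (k : E) : Measurable (fun p => B p k) := by unfold B; fun_prop
lemma K_meas2 (p : E) : Measurable (fun k => K p k) := by unfold K; fun_prop

noncomputable def H (p : E) : ℝ := 2 * π ^ 2 / (√‖p‖ * ‖p‖)

lemma lint_A (p : E) : ∫⁻ k, ENNReal.ofReal (A p k) ≤ ENNReal.ofReal (H p) := by
  rcases (norm_nonneg p).eq_or_lt with hp | hp
  · simp [A, ← hp]
  have : ∀ k : E, ENNReal.ofReal (A p k) = ENNReal.ofReal (1 / √‖p‖) *
      ENNReal.ofReal (1 / (‖k‖ ^ 2 * (‖k‖ ^ 2 + ‖p‖ ^ 2))) := by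
    intro k
    rw [← ENNReal.ofReal_mul (by positivity)]
    congr 1
    unfold A
    rw [div_mul_div_comm, one_mul]
  simp_rw [this]
  rw [lintegral_const_mul _ (by fun_prop), lint_J hp, ← ENNReal.ofReal_mul (by positivity)]
  unfold H
  apply le_of_eq
  congr 1
  rw [div_mul_div_comm, one_mul]

lemma lint_HB (k : E) : ∫⁻ p, ENNReal.ofReal (H p * B p k) ≤ ENNReal.ofReal ((2 * π ^ 2) ^ 2) := by
  rcases (norm_nonneg k).eq_or_lt with hk | hk
  · simp [B, ← hk]
  have : ∀ p : E, ENNReal.ofReal (H p * B p k) = ENNReal.ofReal (2 * π ^ 2 * ‖k‖) *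
      ENNReal.ofReal (1 / (‖p‖ ^ 2 * (‖p‖ ^ 2 + ‖k‖ ^ 2))) := by
    intro p
    rw [← ENNReal.ofReal_mul (by positivity)]
    congr 1
    unfold H B
    rcases (norm_nonneg p).eq_or_lt with hp | hp
    · simp [← hp]
    field_simp
    rw [Real.sq_sqrt hp.le]
  simp_rw [this]
  rw [lintegral_const_mul _ (by fun_prop), lint_J hk, ← ENNReal.ofReal_mul (by positivity)]
  apply le_of_eq
  congr 1
  field_simp

lemma schur_pt (f : E → ℂ) (hf : Measurable f) (p : E) :
    (∫⁻ k, ENNReal.ofReal (K p k) * ‖f k‖ₑ) ^ 2 ≤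
      ∫⁻ k, ENNReal.ofReal (H p * B p k) * ‖f k‖ₑ ^ 2 := by
  have hA : Measurable (fun k => A p k) := A_meas2 p
  have hB : Measurable (fun k => B p k) := B_meas2 p
  have hH : 0 ≤ H p := by unfold H; positivity
  have h := ENNReal.lintegral_mul_le_Lp_mul_Lq (volume : Measure E) Real.HolderConjugate.two_two
    (f := fun k => ENNReal.ofReal (√(A p k)))
    (g := fun k => ENNReal.ofReal (√(B p k)) * ‖f k‖ₑ) (by fun_prop) (by fun_prop)
  have e1 : ∀ k, ENNReal.ofReal (K p k) * ‖f k‖ₑ = 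
    ((fun k => ENNReal.ofReal (√(A p k))) * (fun k => ENNReal.ofReal (√(B p k)) * ‖f k‖ₑ)) k := by
    intro k
    simp only [Pi.mul_apply]
    rw [K_eq, ENNReal.ofReal_mul (by positivity), mul_assoc]
  simp_rw [← e1] at h
  have e2 : ∀ k, ENNReal.ofReal (√(A p k)) ^ (2:ℝ) = ENNReal.ofReal (A p k) := by
    intro k
    rw [ENNReal.rpow_two, ← ENNReal.ofReal_pow (by positivity), Real.sq_sqrt (A_nonneg p k)]
  have e3 : ∀ k, (ENNReal.ofReal (√(B p k)) * ‖f k‖ₑ) ^ (2:ℝ) = ENNReal.ofReal (B p k) * ‖f k‖ₑ ^ 2 := by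
    intro k
    rw [ENNReal.rpow_two, mul_pow, ← ENNReal.ofReal_pow (by positivity), Real.sq_sqrt (B_nonneg p k)]
  simp_rw [e2, e3] at h
  calc _ ≤ _ := pow_le_pow_left' h 2
    _ = (∫⁻ k, ENNReal.ofReal (A p k)) * ∫⁻ k, ENNReal.ofReal (B p k) * ‖f k‖ₑ ^ 2 := by
      rw [mul_pow, ← ENNReal.rpow_two, ← ENNReal.rpow_two, ← ENNReal.rpow_mul, ← ENNReal.rpow_mul]
      norm_num
    _ ≤ ENNReal.ofReal (H p) * ∫⁻ k, ENNReal.ofReal (B p k) * ‖f k‖ₑ ^ 2 := by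
      gcongr; exact lint_A p
    _ = _ := by
      rw [← lintegral_const_mul _ (by fun_prop)]
      simp_rw [ENNReal.ofReal_mul hH, mul_assoc]

lemma schur (f : E → ℂ) (hf : Measurable f) :
    ∫⁻ p, (∫⁻ k, ENNReal.ofReal (K p k) * ‖f k‖ₑ) ^ 2 ≤
      ENNReal.ofReal ((2 * π ^ 2) ^ 2) * ∫⁻ k, ‖f k‖ₑ ^ 2 := by
  have hB := B_meas
  have hHm : Measurable H := by unfold H; fun_prop
  calc _ ≤ _ := lintegral_mono (schur_pt f hf)
    _ = ∫⁻ k, ∫⁻ p, ENNReal.ofReal (H p * B p k) * ‖f k‖ₑ ^ 2 := by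
      apply lintegral_lintegral_swap
      apply Measurable.aemeasurable
      unfold Function.uncurry
      fun_prop
    _ = ∫⁻ k, (∫⁻ p, ENNReal.ofReal (H p * B p k)) * ‖f k‖ₑ ^ 2 := by
      congr 1; ext k
      rw [lintegral_mul_const]
      have : Measurable (fun p => B p k) := B_meas1 k
      fun_prop
    _ ≤ ∫⁻ k, ENNReal.ofReal ((2 * π ^ 2) ^ 2) * ‖f k‖ₑ ^ 2 := by
      apply lintegral_mono; intro k; dsimp only; gcongr; exact lint_HB k
    _ = _ := by rw [lintegral_const_mul _ (by fun_prop)]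

noncomputable def T (f : E → ℂ) (p : E) : ℂ := ∫ k, f k * (K p k : ℂ)

lemma enorm_fK (f : E → ℂ) (p k : E) :
    ‖f k * (K p k : ℂ)‖ₑ = ENNReal.ofReal (K p k) * ‖f k‖ₑ := by
  rw [enorm_mul, mul_comm]
  congr 1
  rw [← ofReal_norm, Complex.norm_real, Real.norm_of_nonneg (K_nonneg p k)]

lemma T_meas (f : E → ℂ) (hf : StronglyMeasurable f) : StronglyMeasurable (T f) := by
  unfold T
  apply StronglyMeasurable.integral_prod_right (f := fun p k => f k * (K p k : ℂ))
  apply Measurable.stronglyMeasurable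
  have := K_meas
  have := hf.measurable
  unfold Function.uncurry
  fun_prop

noncomputable abbrev L2 := Lp ℂ 2 (volume : Measure E)

lemma lint_sq (f : L2) : ∫⁻ k, ‖f k‖ₑ ^ 2 = ENNReal.ofReal (‖f‖ ^ 2) := by
  have h : eLpNorm f 2 volume ^ 2 = ∫⁻ k, ‖f k‖ₑ ^ 2 := by
    rw [eLpNorm_eq_lintegral_rpow_enorm_toReal (by simp) (by simp)]
    simp only [ENNReal.toReal_ofNat]
    rw [← ENNReal.rpow_two, ← ENNReal.rpow_mul]
    norm_num
  rw [← h, Lp.norm_def, ENNReal.ofReal_pow ENNReal.toReal_nonneg,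
    ENNReal.ofReal_toReal (Lp.eLpNorm_ne_top f)]

lemma fK_integrable (f : L2) : ∀ᵐ p : E, Integrable (fun k => f k * (K p k : ℂ)) := by
  have hf : Measurable f := (Lp.stronglyMeasurable f).measurable
  have h := schur f hf
  have hm : Measurable (fun p => (∫⁻ k, ENNReal.ofReal (K p k) * ‖f k‖ₑ) ^ 2) := by
    apply Measurable.pow_const
    apply Measurable.lintegral_prod_right' (f := fun z : E × E => ENNReal.ofReal (K z.1 z.2) * ‖f z.2‖ₑ)
    have := K_meas
    fun_prop
  rw [lint_sq] at h
  have h2 := ae_lt_top hm (ne_top_of_le_ne_top (by finiteness) h)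
  filter_upwards [h2] with p hp
  have hKp : Measurable (fun k => K p k) := K_meas2 p
  refine ⟨by apply Measurable.aestronglyMeasurable; fun_prop, ?_⟩
  rw [hasFiniteIntegral_iff_enorm]
  simp_rw [enorm_fK]
  by_contra hc
  rw [not_lt, top_le_iff] at hc
  rw [hc] at hp
  simp at hp

lemma T_lint (f : L2) : ∫⁻ p, ‖T f p‖ₑ ^ 2 ≤ ENNReal.ofReal ((2 * π ^ 2 * ‖f‖) ^ 2) := by
  have hf : Measurable f := (Lp.stronglyMeasurable f).measurable
  rw [mul_pow, ENNReal.ofReal_mul (by positivity), ← lint_sq]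
  refine le_trans (lintegral_mono fun p => ?_) (schur f hf)
  dsimp only
  gcongr
  refine (enorm_integral_le_lintegral_enorm _).trans ?_
  simp_rw [enorm_fK]
  rfl

lemma T_eLp (f : L2) : eLpNorm (T f) 2 volume ≤ ENNReal.ofReal (2 * π ^ 2 * ‖f‖) := by
  rw [eLpNorm_eq_lintegral_rpow_enorm_toReal (by simp) (by simp)]
  simp only [ENNReal.toReal_ofNat, ENNReal.rpow_two]
  refine (ENNReal.rpow_le_rpow (T_lint f) (by norm_num)).trans ?_
  rw [ENNReal.ofReal_pow (by positivity), ← ENNReal.rpow_two, ← ENNReal.rpow_mul]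
  norm_num

lemma T_memLp (f : L2) : MemLp (T f) 2 volume :=
  ⟨(T_meas f (Lp.stronglyMeasurable f)).aestronglyMeasurable, (T_eLp f).trans_lt (by finiteness)⟩

lemma T_add (f g : L2) : T (f + g : L2) =ᵐ[volume] T f + T g := by
  filter_upwards [fK_integrable f, fK_integrable g] with p h1 h2
  simp only [T, Pi.add_apply]
  rw [← integral_add h1 h2]
  apply integral_congr_ae
  filter_upwards [Lp.coeFn_add f g] with k hk
  rw [hk, Pi.add_apply, add_mul]

lemma T_smul (c : ℂ) (f : L2) : T (c • f : L2) = c • T f := by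
  ext p
  simp only [T, Pi.smul_apply, smul_eq_mul]
  rw [← integral_const_mul]
  apply integral_congr_ae
  filter_upwards [Lp.coeFn_smul c f] with k hk
  rw [hk, Pi.smul_apply, smul_eq_mul, mul_assoc]

noncomputable def Qlin : L2 →ₗ[ℂ] L2 where
  toFun f := (T_memLp f).toLp _
  map_add' f g := by
    rw [← MemLp.toLp_add]
    exact MemLp.toLp_congr _ _ (T_add f g)
  map_smul' c f := by
    rw [RingHom.id_apply, ← MemLp.toLp_const_smul]
    exact MemLp.toLp_congr _ _ (by rw [T_smul])

lemma Qlin_bound (f : L2) : ‖Qlin f‖ ≤ 2 * π ^ 2 * ‖f‖ := by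
  change ‖(T_memLp f).toLp _‖ ≤ _
  rw [Lp.norm_toLp]
  exact ENNReal.toReal_le_of_le_ofReal (by positivity) (T_eLp f)

noncomputable def Q : L2 →L[ℂ] L2 := Qlin.mkContinuous (2 * π ^ 2) Qlin_bound

lemma Q_norm_le : ‖Q‖ ≤ 2 * π ^ 2 := LinearMap.mkContinuous_norm_le _ (by positivity) _

lemma Q_ae (f : L2) : (Q f : E → ℂ) =ᵐ[volume] T f := (T_memLp f).coeFn_toLp

end QOp

namespace QOp

lemma radial_Ioc {R : ℝ} (hR : 1 < R) (f F : ℝ → ℝ) (hF : ContinuousOn F (Set.Icc 1 R))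
    (h : ∀ y, 0 < y → y ^ 2 * f y = (Set.Ioc 1 R).indicator F y) :
    Integrable (fun x : E => f ‖x‖) ∧ ∫ x : E, f ‖x‖ = 4 * π * ∫ y in (1:ℝ)..R, F y := by
  have hc : Set.EqOn (fun y : ℝ => y ^ 2 * f y) ((Set.Ioc 1 R).indicator F) (Set.Ioi 0) :=
    fun y hy => h y hy
  have hi : IntegrableOn F (Set.Ioc 1 R) :=
    (hF.integrableOn_Icc).mono_set Set.Ioc_subset_Icc_self
  have hsub : Set.Ioi (0:ℝ) ∩ Set.Ioc 1 R = Set.Ioc 1 R := by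
    apply Set.inter_eq_right.2
    intro y hy
    exact lt_trans one_pos hy.1
  constructor
  · apply radial_integrable
    rw [integrableOn_congr_fun hc measurableSet_Ioi]
    exact (hi.integrable_indicator measurableSet_Ioc).integrableOn
  · rw [radial, setIntegral_congr_fun measurableSet_Ioi hc,
      setIntegral_indicator measurableSet_Ioc, hsub, intervalIntegral.integral_of_le hR.le]

noncomputable def g (R : ℝ) : ℝ → ℝ := (Set.Ioc 1 R).indicator (fun r => 1 / (r * √r))

lemma g_meas (R : ℝ) : Measurable (g R) := by
  unfold g
  apply Measurable.indicator _ measurableSet_Ioc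
  fun_prop

lemma g_sq {R : ℝ} (hR : 1 < R) :
    Integrable (fun x : E => (g R ‖x‖) ^ 2) ∧ ∫ x : E, (g R ‖x‖) ^ 2 = 4 * π * log R := by
  have h := radial_Ioc hR (fun y => (g R y) ^ 2) (fun y => 1 / y) ?_ ?_
  · refine ⟨h.1, h.2.trans ?_⟩
    rw [integral_one_div_of_pos one_pos (by linarith), div_one]
  · apply ContinuousOn.div continuousOn_const continuousOn_id
    intro y hy
    exact (lt_of_lt_of_le one_pos hy.1).ne'
  · intro y hy
    by_cases hm : y ∈ Set.Ioc 1 R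
    · simp only [g, Set.indicator_of_mem hm]
      field_simp
      rw [Real.sq_sqrt hy.le]
    · simp [g, Set.indicator_of_notMem hm]

noncomputable def w (R r : ℝ) : ℝ := arctan (R / r) - arctan (1 / r)

lemma w_lower {R r : ℝ} (hR : 1 < R) (hr : 0 < r) : π / 2 - r / R - 1 / r ≤ w R r := by
  have hle : ∀ x : ℝ, 0 ≤ x → arctan x ≤ x := by
    intro x hx
    have := le_tan (arctan_nonneg.2 hx) (arctan_lt_pi_div_two x)
    rwa [tan_arctan] at this
  have h1 := arctan_inv_of_pos (x := r / R) (by positivity)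
  rw [inv_div] at h1
  have h2 := hle (r / R) (by positivity)
  have h3 := hle (1 / r) (by positivity)
  unfold w
  linarith

lemma inner_int {R : ℝ} (hR : 1 < R) (p : E) (hp : 0 < ‖p‖) :
    ∫ k : E, g R ‖k‖ * K p k = 4 * π * (w R ‖p‖ / (‖p‖ * √‖p‖)) := by
  have h := radial_Ioc hR
    (fun y => g R y * (1 / (√‖p‖ * (‖p‖ ^ 2 + y ^ 2) * √y)))
    (fun y => 1 / √‖p‖ * (‖p‖ ^ 2 + y ^ 2)⁻¹) ?_ ?_
  · refine h.2.trans ?_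
    rw [intervalIntegral.integral_const_mul, integral_inv_sq_add_sq hp.ne']
    unfold w
    field_simp
  · apply Continuous.continuousOn
    apply Continuous.mul continuous_const
    apply Continuous.inv₀ (by fun_prop)
    intro y
    positivity
  · intro y hy
    by_cases hm : y ∈ Set.Ioc 1 R
    · simp only [g, Set.indicator_of_mem hm]
      field_simp
      rw [Real.sq_sqrt hy.le]
    · simp [g, Set.indicator_of_notMem hm]

lemma outer_int {R : ℝ} (hR : 1 < R) :
    ∫ p : E, g R ‖p‖ * (4 * π * (w R ‖p‖ / (‖p‖ * √‖p‖))) =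
      4 * π * (4 * π * ∫ y in (1:ℝ)..R, w R y / y) ∧
    π / 2 * log R - 2 ≤ ∫ y in (1:ℝ)..R, w R y / y := by
  have hcont : ContinuousOn (fun y => w R y / y) (Set.Icc 1 R) := by
    have hne : ∀ y ∈ Set.Icc 1 R, y ≠ 0 := fun y hy => (lt_of_lt_of_le one_pos hy.1).ne'
    unfold w
    apply ContinuousOn.div _ continuousOn_id hne
    apply ContinuousOn.sub
    · exact continuous_arctan.comp_continuousOn (continuousOn_const.div continuousOn_id hne)
    · exact continuous_arctan.comp_continuousOn (continuousOn_const.div continuousOn_id hne)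
  constructor
  · have h := radial_Ioc hR
      (fun y => g R y * (4 * π * (w R y / (y * √y))))
      (fun y => 4 * π * (w R y / y)) (continuousOn_const.mul hcont) ?_
    · rw [h.2, intervalIntegral.integral_const_mul]
    · intro y hy
      by_cases hm : y ∈ Set.Ioc 1 R
      · simp only [g, Set.indicator_of_mem hm]
        field_simp
        rw [Real.sq_sqrt hy.le]
      · simp [g, Set.indicator_of_notMem hm]
  · have hder : ∀ y ∈ Set.uIcc 1 R,
        HasDerivAt (fun y => π / 2 * log y - y / R + y⁻¹) (π / 2 * y⁻¹ - 1 / R + (-(y ^ 2)⁻¹)) y := by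
      intro y hy
      rw [Set.uIcc_of_le hR.le] at hy
      have hy0 : y ≠ 0 := (lt_of_lt_of_le one_pos hy.1).ne'
      exact (((Real.hasDerivAt_log hy0).const_mul _).sub ((hasDerivAt_id y).div_const R)).add
        (hasDerivAt_inv hy0)
    have hci : ContinuousOn (fun y : ℝ => π / 2 * y⁻¹ - 1 / R + (-(y ^ 2)⁻¹)) (Set.uIcc 1 R) := by
      rw [Set.uIcc_of_le hR.le]
      have hne : ∀ y ∈ Set.Icc 1 R, y ≠ 0 := fun y hy => (lt_of_lt_of_le one_pos hy.1).ne'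
      have hi : ContinuousOn (fun y : ℝ => y⁻¹) (Set.Icc 1 R) := continuousOn_id.inv₀ hne
      have hi2 : ContinuousOn (fun y : ℝ => (y ^ 2)⁻¹) (Set.Icc 1 R) :=
        (continuousOn_id.pow 2).inv₀ (fun y hy => pow_ne_zero 2 (hne y hy))
      exact ((continuousOn_const.mul hi).sub continuousOn_const).add hi2.neg
    have hint := intervalIntegral.integral_eq_sub_of_hasDerivAt hder hci.intervalIntegrable
    have hmono : ∫ y in (1:ℝ)..R, (π / 2 * y⁻¹ - 1 / R + (-(y ^ 2)⁻¹)) ≤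
        ∫ y in (1:ℝ)..R, w R y / y := by
      apply intervalIntegral.integral_mono_on hR.le hci.intervalIntegrable
      · apply ContinuousOn.intervalIntegrable
        rwa [Set.uIcc_of_le hR.le]
      · intro y hy
        have hy0 : 0 < y := lt_of_lt_of_le one_pos hy.1
        rw [le_div_iff₀ hy0]
        refine le_trans (le_of_eq ?_) (w_lower hR hy0)
        field_simp
        try ring
    rw [hint] at hmono
    have hR0 : 0 < R := by linarith
    have e1 : R / R = 1 := div_self hR0.ne'
    have e2 : 0 < R⁻¹ := by positivity
    have e3 : 0 < 1 / R := by positivity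
    simp only [log_one, inv_one, e1] at hmono
    linarith

noncomputable def gc (R : ℝ) (x : E) : ℂ := (g R ‖x‖ : ℂ)

lemma gc_memLp {R : ℝ} (hR : 1 < R) : MemLp (gc R) 2 (volume : Measure E) := by
  have hm : Measurable (gc R) := by
    unfold gc
    have := g_meas R
    fun_prop
  rw [memLp_two_iff_integrable_sq_norm hm.aestronglyMeasurable]
  simpa [gc] using (g_sq hR).1

lemma lower {R : ℝ} (hR : 1 < R) :
    4 * π * (4 * π * (π / 2 * log R - 2)) ≤ ‖Q‖ * (4 * π * log R) := by
  set ψ : L2 := (gc_memLp hR).toLp _ with hψ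
  have hψae : (ψ : E → ℂ) =ᵐ[volume] gc R := (gc_memLp hR).coeFn_toLp
  have hnorm : ‖ψ‖ ^ 2 = 4 * π * log R := by
    rw [← (g_sq hR).2]
    have h := lint_sq ψ
    have h2 : ∫⁻ k, ‖ψ k‖ₑ ^ 2 = ENNReal.ofReal (∫ x : E, (g R ‖x‖) ^ 2) := by
      rw [ofReal_integral_eq_lintegral_ofReal (g_sq hR).1
        (Filter.Eventually.of_forall fun x => by positivity)]
      apply lintegral_congr_ae
      filter_upwards [hψae] with x hx
      rw [hx, gc, ← ofReal_norm, Complex.norm_real, ← ENNReal.ofReal_pow (norm_nonneg _),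
        Real.norm_eq_abs, sq_abs]
    rw [h2] at h
    exact ((ENNReal.ofReal_eq_ofReal_iff (integral_nonneg fun x => by positivity)
      (by positivity)).1 h).symm
  have hinner : inner ℂ ψ (Q ψ) =
      ((∫ p : E, g R ‖p‖ * (4 * π * (w R ‖p‖ / (‖p‖ * √‖p‖))) : ℝ) : ℂ) := by
    rw [L2.inner_def, ← integral_complex_ofReal]
    apply integral_congr_ae
    have h0 : ∀ᵐ p : E, p ≠ 0 := by
      simp [ae_iff]
    filter_upwards [hψae, Q_ae ψ, h0] with p h1 h2 h3
    have hT : T ψ p = ((∫ k : E, g R ‖k‖ * K p k : ℝ) : ℂ) := by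
      unfold T
      rw [← integral_complex_ofReal]
      apply integral_congr_ae
      filter_upwards [hψae] with k hk
      rw [hk, gc]
      push_cast
      rfl
    rw [h1, h2, hT, inner_int hR p (norm_pos_iff.2 h3), gc]
    simp only [RCLike.inner_apply, Complex.conj_ofReal]
    push_cast
    ring
  have hcs : ‖inner ℂ ψ (Q ψ)‖ ≤ ‖Q‖ * ‖ψ‖ ^ 2 := by
    calc _ ≤ ‖ψ‖ * ‖Q ψ‖ := norm_inner_le_norm _ _
      _ ≤ ‖ψ‖ * (‖Q‖ * ‖ψ‖) := by gcongr; exact Q.le_opNorm ψ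
      _ = _ := by ring
  rw [hinner, (outer_int hR).1, hnorm, Complex.norm_real] at hcs
  refine le_trans ?_ ((le_abs_self _).trans hcs)
  have := (outer_int hR).2
  gcongr

lemma Q_norm : ‖Q‖ = 2 * π ^ 2 := by
  apply le_antisymm Q_norm_le
  by_contra! hlt
  have hd : 0 < 2 * π ^ 2 - ‖Q‖ := by linarith
  set L := (8 * π + 1) / (2 * π ^ 2 - ‖Q‖) with hL
  have hLpos : 0 < L := by positivity
  have h := lower (R := exp L) (one_lt_exp_iff.2 hLpos)
  rw [log_exp] at h
  have hLd : L * (2 * π ^ 2 - ‖Q‖) = 8 * π + 1 := by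
    rw [hL]; exact div_mul_cancel₀ _ hd.ne'
  have h' : 4 * π * (4 * π * (π / 2 * L - 2)) ≤ 4 * π * (‖Q‖ * L) := by linarith
  have h2 := le_of_mul_le_mul_left h' (by positivity)
  linarith

end QOp

/-- The integral operator `(Qψ)(p) = ∫ ψ(k) / (√|p| (|p|²+|k|²) √|k|) dk` is a bounded
operator on `L²(ℝ³)` with operator norm `2π²`. -/
theorem integral_operator_bounded_norm :
    ∃ Q : Lp ℂ 2 (volume : Measure (EuclideanSpace ℝ (Fin 3))) →L[ℂ]
          Lp ℂ 2 (volume : Measure (EuclideanSpace ℝ (Fin 3))),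
      ‖Q‖ = 2 * π ^ 2 ∧
      ∀ ψ : Lp ℂ 2 (volume : Measure (EuclideanSpace ℝ (Fin 3))),
        (Q ψ : EuclideanSpace ℝ (Fin 3) → ℂ) =ᵐ[volume]
          fun p => ∫ k : EuclideanSpace ℝ (Fin 3),
            ψ k / ((Real.sqrt ‖p‖ * (‖p‖ ^ 2 + ‖k‖ ^ 2) * Real.sqrt ‖k‖ : ℝ) : ℂ) := by
  refine ⟨QOp.Q, QOp.Q_norm, fun ψ => (QOp.Q_ae ψ).trans (Filter.Eventually.of_forall fun p => ?_)⟩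
  simp only [QOp.T, QOp.K]
  congr 1
  ext k
  rw [one_div, Complex.ofReal_inv, div_eq_mul_inv]
end

section
/- For every a > 0 and every nonzero x ∈ ℝ³, the integral over k ∈ ℝ³ of e^{i k·x}/(|k|² + a²) equals (2π²/|x|) e^{−a|x|}. -/
open MeasureTheory Real Filter
open scoped RealInnerProductSpace Topology

lemma laplace_aux (z : ℂ) (hz : 0 < z.re) :
    IntegrableOn (fun v : ℝ => (v : ℂ) * Complex.exp (-z * v)) (Set.Ioi 0) ∧
    ∫ v in Set.Ioi (0:ℝ), (v : ℂ) * Complex.exp (-z * v) = 1 / z ^ 2 := by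
  have hz0 : z ≠ 0 := by rintro rfl; simp at hz
  have hn : ∀ v : ℝ, ‖Complex.exp (-z * v)‖ = Real.exp (-z.re * v) := by
    intro v; rw [Complex.norm_exp]; simp
  have hi : IntegrableOn (fun v : ℝ => (v : ℂ) * Complex.exp (-z * v)) (Set.Ioi 0) := by
    have h := integrableOn_rpow_mul_exp_neg_mul_rpow (p := 1) (s := 1) (b := z.re)
      (by norm_num) (by norm_num) hz
    refine Integrable.mono' h (Continuous.aestronglyMeasurable (by fun_prop)) ?_
    filter_upwards [ae_restrict_mem measurableSet_Ioi] with v hv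
    rw [norm_mul, hn, Complex.norm_real, Real.norm_of_nonneg (le_of_lt hv)]
    simp
  refine ⟨hi, ?_⟩
  have hT : Tendsto (fun v : ℝ => -((v : ℂ) / z + 1 / z ^ 2) * Complex.exp (-z * v))
      atTop (𝓝 0) := by
    have h1 : Tendsto (fun v : ℝ => (v : ℂ) * Complex.exp (-z * v)) atTop (𝓝 0) := by
      rw [tendsto_zero_iff_norm_tendsto_zero]
      have := Real.tendsto_pow_mul_exp_neg_atTop_nhds_zero 1
      have h2 := (this.comp (tendsto_id.const_mul_atTop hz)).const_mul (z.re)⁻¹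
      rw [mul_zero] at h2
      refine h2.congr' ?_
      filter_upwards [eventually_ge_atTop 0] with v hv
      rw [norm_mul, hn, Complex.norm_real, Real.norm_of_nonneg hv]
      simp; field_simp
    have h0 : Tendsto (fun v : ℝ => Complex.exp (-z * v)) atTop (𝓝 0) := by
      rw [tendsto_zero_iff_norm_tendsto_zero]
      have := Real.tendsto_pow_mul_exp_neg_atTop_nhds_zero 0
      refine (this.comp (tendsto_id.const_mul_atTop hz)).congr ?_
      intro v; rw [hn]; simp
    have := (h1.const_mul (-1 / z)).add (h0.const_mul (-1 / z ^ 2))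
    simp only [mul_zero, add_zero] at this
    refine this.congr ?_
    intro v; ring
  have hd : ∀ v ∈ Set.Ici (0:ℝ), HasDerivAt
      (fun v : ℝ => -((v : ℂ) / z + 1 / z ^ 2) * Complex.exp (-z * v))
      ((v : ℂ) * Complex.exp (-z * v)) v := by
    intro v _
    have hv : HasDerivAt (fun v : ℝ => (v : ℂ)) 1 v := Complex.ofRealCLM.hasDerivAt
    have h1 := ((hv.div_const z).add_const (1 / z ^ 2)).neg
    have h2 := (hv.const_mul (-z)).cexp
    refine (h1.mul h2).congr_deriv ?_
    simp only [Pi.neg_apply]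
    field_simp; ring
  rw [integral_Ioi_of_hasDerivAt_of_tendsto' hd hi hT]
  simp

lemma fourier_aux (a s : ℝ) (ha : 0 < a) (hs : 0 < s) :
    Integrable (fun t : ℝ => Complex.exp (Complex.I * s * t) *
      ((a ^ 2 - t ^ 2) / (t ^ 2 + a ^ 2) ^ 2 : ℝ)) ∧
    ∫ t : ℝ, Complex.exp (Complex.I * s * t) * ((a ^ 2 - t ^ 2) / (t ^ 2 + a ^ 2) ^ 2 : ℝ)
      = (π * s * Real.exp (-a * s) : ℝ) := by
  have hG : Integrable (fun t : ℝ => (a ^ 2 - t ^ 2) / (t ^ 2 + a ^ 2) ^ 2) := by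
    have h := ((integrable_inv_one_add_sq).comp_div (R := a) ha.ne').const_mul (a ^ 2)⁻¹
    refine Integrable.mono' h ?_ (ae_of_all _ fun t => ?_)
    · refine Continuous.aestronglyMeasurable ?_
      refine Continuous.div (by fun_prop) (by fun_prop) (fun t => by positivity)
    · have : (a ^ 2)⁻¹ * (1 + (t / a) ^ 2)⁻¹ = 1 / (t ^ 2 + a ^ 2) := by
        field_simp; ring
      rw [this, norm_div, Real.norm_of_nonneg (r := (t ^ 2 + a ^ 2) ^ 2) (by positivity),
        div_le_div_iff₀ (by positivity) (by positivity)]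
      have : ‖a ^ 2 - t ^ 2‖ ≤ t ^ 2 + a ^ 2 := by
        rw [Real.norm_eq_abs, abs_le]; constructor <;> nlinarith [sq_nonneg a, sq_nonneg t]
      nlinarith [sq_nonneg a, sq_nonneg t]
  have hGs : ∀ s : ℝ, Integrable (fun t : ℝ => Complex.exp (Complex.I * s * t) *
      ((a ^ 2 - t ^ 2) / (t ^ 2 + a ^ 2) ^ 2 : ℝ)) := by
    intro s
    refine hG.ofReal.bdd_mul (c := 1) (Continuous.aestronglyMeasurable (by fun_prop))
      (ae_of_all _ fun t => ?_)
    rw [Complex.norm_exp]; simp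
  refine ⟨hGs s, ?_⟩
  let f : ℝ → ℂ := fun v => (|v| * Real.exp (-a * |v|) : ℝ)
  have hfc : Continuous f := by fun_prop
  have key : ∀ z : ℂ, z.re = 0 → ∀ v ∈ Set.Ioi (0:ℝ),
      Complex.exp (z * v) * f v = (v : ℂ) * Complex.exp (-(a - z) * v) := by
    intro z hz v hv
    simp only [f, abs_of_pos (show 0 < v from hv)]
    push_cast
    rw [mul_left_comm, ← Complex.exp_add]; congr 1; ring_nf
  have hpos : ∀ z : ℂ, z.re = 0 → IntegrableOn (fun v : ℝ => Complex.exp (z * v) * f v) (Set.Ioi 0)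
      ∧ ∫ v in Set.Ioi (0:ℝ), Complex.exp (z * v) * f v = 1 / (a - z) ^ 2 := by
    intro z hz
    have h := laplace_aux (a - z) (by simp [hz, ha])
    refine ⟨h.1.congr_fun (fun v hv => (key z hz v hv).symm) measurableSet_Ioi, ?_⟩
    rw [← h.2]
    exact setIntegral_congr_fun measurableSet_Ioi (key z hz)
  have hsym : ∀ (z : ℂ) (v : ℝ), Complex.exp (z * (-v : ℝ)) * f (-v) = Complex.exp (-z * v) * f v := by
    intro z v
    simp [f]
  have hneg : ∀ z : ℂ, z.re = 0 → IntegrableOn (fun v : ℝ => Complex.exp (z * v) * f v) (Set.Iic 0)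
      ∧ ∫ v in Set.Iic (0:ℝ), Complex.exp (z * v) * f v = 1 / (a + z) ^ 2 := by
    intro z hz
    have h := hpos (-z) (by simp [hz])
    constructor
    · have h1 := (integrableOn_Ici_iff_integrableOn_Ioi).2 h.1
      have h2 := (integrableOn_Iic_iff_integrableOn_Iio (μ := volume) (b := (0:ℝ))
        (f := fun v : ℝ => Complex.exp (z * v) * f v)).2
      apply h2
      have h3 := (Measure.measurePreserving_neg (volume : Measure ℝ)).integrableOn_comp_preimage
        (MeasurableEquiv.neg ℝ).measurableEmbedding (f := fun v : ℝ => Complex.exp (z * v) * f v) (s := Set.Iio 0)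
      rw [← h3]
      simp only [Function.comp_def, hsym]
      simpa using h.1
    · have := integral_comp_neg_Ioi (0:ℝ) (fun v : ℝ => Complex.exp (z * v) * f v)
      rw [neg_zero] at this
      rw [← this]
      simp only [hsym]
      rw [h.2]; ring
  have hfull : ∀ z : ℂ, z.re = 0 → Integrable (fun v : ℝ => Complex.exp (z * v) * f v)
      ∧ ∫ v : ℝ, Complex.exp (z * v) * f v = 1 / (a + z) ^ 2 + 1 / (a - z) ^ 2 := by
    intro z hz
    have hI : Integrable (fun v : ℝ => Complex.exp (z * v) * f v) := by
      rw [← integrableOn_univ, ← Set.Iic_union_Ioi (a := (0:ℝ))]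
      exact (hneg z hz).1.union (hpos z hz).1
    refine ⟨hI, ?_⟩
    rw [← integral_add_compl measurableSet_Iic hI (s := Set.Iic 0), Set.compl_Iic,
      (hneg z hz).2, (hpos z hz).2]
  have hF : FourierTransform.fourier f = fun w : ℝ =>
      ((2 * ((a ^ 2 - (2 * π * w) ^ 2) / ((2 * π * w) ^ 2 + a ^ 2) ^ 2) : ℝ) : ℂ) := by
    ext w
    rw [Real.fourier_real_eq_integral_exp_smul]
    have h := (hfull (-(2 * π * w : ℝ) * Complex.I) (by simp)).2
    have e : ∀ v : ℝ, Complex.exp (↑(-2 * π * v * w) * Complex.I) • f v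
      = Complex.exp (-(2 * π * w : ℝ) * Complex.I * v) * f v := by
      intro v; rw [smul_eq_mul]; congr 2; push_cast; ring
    simp only [e]
    rw [h]
    set y : ℝ := 2 * π * w
    have h1 : (a + -(y:ℂ) * Complex.I) ≠ 0 := by
      intro h; have := congrArg Complex.re h; simp at this; linarith
    have h2 : (a - -(y:ℂ) * Complex.I) ≠ 0 := by
      intro h; have := congrArg Complex.re h; simp at this; linarith
    have h3 : ((y:ℂ) ^ 2 + a ^ 2) = (a + -(y:ℂ) * Complex.I) * (a - -(y:ℂ) * Complex.I) := by
      ring_nf; simp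
    have h4 : 2 * ((a:ℂ) ^ 2 - y ^ 2) =
        (a + -(y:ℂ) * Complex.I) ^ 2 + (a - -(y:ℂ) * Complex.I) ^ 2 := by
      ring_nf; simp; ring
    push_cast
    rw [h3, ← mul_div_assoc, h4]
    generalize (a + -(y:ℂ) * Complex.I) = p at h1
    generalize (a - -(y:ℂ) * Complex.I) = q at h2
    field_simp
    ring
  have hfi : Integrable f := by simpa using (hfull 0 (by simp)).1
  have h2π : (2 * π) ≠ 0 := by positivity
  have hinv := hfi.fourierInv_fourier_eq (by
    rw [hF]
    exact ((hG.comp_mul_left' h2π).const_mul 2).ofReal) (v := s) hfc.continuousAt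
  rw [hF, Real.fourierInv_eq'] at hinv
  have hsub := Measure.integral_comp_mul_left (fun t : ℝ => Complex.exp (Complex.I * s * t) *
      ((a ^ 2 - t ^ 2) / (t ^ 2 + a ^ 2) ^ 2 : ℝ)) (2 * π)
  have e : ∀ v : ℝ, Complex.exp (↑(2 * π * inner ℝ v s) * Complex.I) •
      ((2 * ((a ^ 2 - (2 * π * v) ^ 2) / ((2 * π * v) ^ 2 + a ^ 2) ^ 2) : ℝ) : ℂ)
      = 2 * (Complex.exp (Complex.I * s * (2 * π * v : ℝ)) *
      ((a ^ 2 - (2 * π * v) ^ 2) / ((2 * π * v) ^ 2 + a ^ 2) ^ 2 : ℝ)) := by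
    intro v
    have : (↑(2 * π * inner ℝ v s) * Complex.I) = Complex.I * s * (2 * π * v : ℝ) := by
      simp; ring
    rw [this, smul_eq_mul]; push_cast; ring
  simp only [e] at hinv
  rw [integral_const_mul, hsub, abs_of_pos (by positivity)] at hinv
  simp only [f, abs_of_pos hs, Complex.real_smul] at hinv
  have hπ : (π : ℂ) ≠ 0 := by exact_mod_cast pi_ne_zero
  push_cast at hinv ⊢
  rw [mul_assoc (π:ℂ), ← hinv]
  field_simp

lemma limit_aux (a s : ℝ) (ha : 0 < a) (hs : 0 < s) :
    Tendsto (fun R : ℝ => ∫ t in (-R)..R, ((Real.log (R ^ 2 + a ^ 2) - Real.log (t ^ 2 + a ^ 2) : ℝ) : ℂ)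
      * Complex.exp (Complex.I * s * t)) atTop (𝓝 ((2 * π / s * Real.exp (-a * s) : ℝ) : ℂ)) := by
  have hs0 : (s : ℂ) ≠ 0 := by exact_mod_cast hs.ne'
  have hI := Complex.I_ne_zero
  have hp : ∀ t : ℝ, t ^ 2 + a ^ 2 ≠ 0 := fun t => by positivity
  have hv : ∀ t : ℝ, HasDerivAt (fun t : ℝ => Complex.exp (Complex.I * s * t) / (Complex.I * s))
      (Complex.exp (Complex.I * s * t)) t := by
    intro t
    have hv : HasDerivAt (fun v : ℝ => (v : ℂ)) 1 t := Complex.ofRealCLM.hasDerivAt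
    refine (((hv.const_mul (Complex.I * s)).cexp).div_const (Complex.I * s)).congr_deriv ?_
    field_simp
  have hsq : ∀ t : ℝ, HasDerivAt (fun t : ℝ => t ^ 2 + a ^ 2) (2 * t) t := by
    intro t
    simpa using (hasDerivAt_pow 2 t).add_const (a ^ 2)
  have hu : ∀ R t : ℝ, HasDerivAt (fun t : ℝ =>
      ((Real.log (R ^ 2 + a ^ 2) - Real.log (t ^ 2 + a ^ 2) : ℝ) : ℂ))
      ((-(2 * t / (t ^ 2 + a ^ 2)) : ℝ) : ℂ) t := by
    intro R t
    exact ((((hsq t).log (hp t)).const_sub _)).ofReal_comp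
  have hw : ∀ t : ℝ, HasDerivAt (fun t : ℝ => ((-(2 * t / (t ^ 2 + a ^ 2)) : ℝ) : ℂ))
      ((-2 * ((a ^ 2 - t ^ 2) / (t ^ 2 + a ^ 2) ^ 2) : ℝ) : ℂ) t := by
    intro t
    have := (((hasDerivAt_id t).const_mul 2).div (hsq t) (hp t)).neg
    refine this.ofReal_comp.congr_deriv ?_
    congr 1
    simp only [id]; field_simp; ring
  have hc1 : Continuous (fun t : ℝ => ((-(2 * t / (t ^ 2 + a ^ 2)) : ℝ) : ℂ)) := by
    refine Complex.continuous_ofReal.comp (Continuous.neg ?_)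
    exact Continuous.div (by fun_prop) (by fun_prop) hp
  have hc2 : Continuous (fun t : ℝ => ((-2 * ((a ^ 2 - t ^ 2) / (t ^ 2 + a ^ 2) ^ 2) : ℝ) : ℂ)) := by
    refine Complex.continuous_ofReal.comp (Continuous.mul continuous_const ?_)
    exact Continuous.div (by fun_prop) (by fun_prop) (fun t => pow_ne_zero 2 (hp t))
  have hce : Continuous (fun t : ℝ => Complex.exp (Complex.I * s * t)) := by fun_prop
  have heq : ∀ R : ℝ, ∫ t in (-R)..R, ((Real.log (R ^ 2 + a ^ 2) - Real.log (t ^ 2 + a ^ 2) : ℝ) : ℂ)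
      * Complex.exp (Complex.I * s * t) =
      (1 / s ^ 2 : ℂ) * (((-(2 * R / (R ^ 2 + a ^ 2)) : ℝ) : ℂ) *
        (Complex.exp (Complex.I * s * R) + Complex.exp (Complex.I * s * (-R : ℝ))))
      + (2 / s ^ 2 : ℂ) * ∫ t in (-R)..R, Complex.exp (Complex.I * s * t) *
        ((a ^ 2 - t ^ 2) / (t ^ 2 + a ^ 2) ^ 2 : ℝ) := by
    intro R
    rw [intervalIntegral.integral_mul_deriv_eq_deriv_mul (fun t _ => hu R t) (fun t _ => hv t)
      (hc1.intervalIntegrable _ _) (hce.intervalIntegrable _ _)]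
    have h1 : ∀ t : ℝ, ((-(2 * t / (t ^ 2 + a ^ 2)) : ℝ) : ℂ) *
        (Complex.exp (Complex.I * s * t) / (Complex.I * s)) = (1 / (Complex.I * s)) *
        (((-(2 * t / (t ^ 2 + a ^ 2)) : ℝ) : ℂ) * Complex.exp (Complex.I * s * t)) := by
      intro t; ring
    simp only [h1]
    rw [intervalIntegral.integral_const_mul,
      intervalIntegral.integral_mul_deriv_eq_deriv_mul (fun t _ => hw t) (fun t _ => hv t)
      (hc2.intervalIntegrable _ _) (hce.intervalIntegrable _ _)]
    have h2 : ∀ t : ℝ, ((-2 * ((a ^ 2 - t ^ 2) / (t ^ 2 + a ^ 2) ^ 2) : ℝ) : ℂ) *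
        (Complex.exp (Complex.I * s * t) / (Complex.I * s)) = (-2 / (Complex.I * s)) *
        (Complex.exp (Complex.I * s * t) *
        ((a ^ 2 - t ^ 2) / (t ^ 2 + a ^ 2) ^ 2 : ℝ)) := by
      intro t; push_cast; ring
    simp only [h2]
    rw [intervalIntegral.integral_const_mul]
    generalize (∫ t in (-R)..R, Complex.exp (Complex.I * s * t) *
        ((a ^ 2 - t ^ 2) / (t ^ 2 + a ^ 2) ^ 2 : ℝ)) = J
    have h3 : ((-(2 * (-R) / ((-R) ^ 2 + a ^ 2)) : ℝ) : ℂ) = -((-(2 * R / (R ^ 2 + a ^ 2)) : ℝ) : ℂ) := by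
      rw [← Complex.ofReal_neg]; congr 1; rw [neg_sq]; ring
    rw [h3, neg_sq, sub_self]
    generalize ((-(2 * R / (R ^ 2 + a ^ 2)) : ℝ) : ℂ) = A
    generalize Complex.exp (Complex.I * s * (-R : ℝ)) = B
    generalize Complex.exp (Complex.I * s * R) = C
    field_simp
    simp
  simp only [heq]
  have hlim : Tendsto (fun R : ℝ => ((-(2 * R / (R ^ 2 + a ^ 2)) : ℝ) : ℂ) *
        (Complex.exp (Complex.I * s * R) + Complex.exp (Complex.I * s * (-R : ℝ)))) atTop (𝓝 0) := by
    refine squeeze_zero_norm' (a := fun R : ℝ => 4 * R⁻¹) ?_ (by simpa using tendsto_inv_atTop_zero.const_mul (4:ℝ))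
    filter_upwards [eventually_gt_atTop 0] with R hR
    have h1 : ‖Complex.exp (Complex.I * s * R) + Complex.exp (Complex.I * s * (-R : ℝ))‖ ≤ 2 := by
      refine (norm_add_le _ _).trans ?_
      rw [Complex.norm_exp, Complex.norm_exp]; simp; norm_num
    have h2 : ‖((-(2 * R / (R ^ 2 + a ^ 2)) : ℝ) : ℂ)‖ ≤ 2 * R⁻¹ := by
      rw [Complex.norm_real, norm_neg, Real.norm_of_nonneg (by positivity), ← div_eq_mul_inv,
        div_le_div_iff₀ (by positivity) hR]
      nlinarith [sq_nonneg a]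
    rw [norm_mul]
    calc _ ≤ (2 * R⁻¹) * 2 := by gcongr
      _ = _ := by ring
  have hF := fourier_aux a s ha hs
  have h := (hlim.const_mul (1 / s ^ 2 : ℂ)).add ((intervalIntegral_tendsto_integral hF.1
    tendsto_neg_atTop_atBot tendsto_id).const_mul (2 / s ^ 2 : ℂ))
  rw [hF.2] at h
  simp only [id] at h
  convert h using 2
  push_cast
  field_simp
  simp

/-- The integrand in cylindrical coordinates around the direction of `x`. -/
noncomputable def cylFun (a s R : ℝ) (p : ℝ × ℂ) : ℂ :=
  {p : ℝ × ℂ | p.1 ^ 2 + ‖p.2‖ ^ 2 < R ^ 2}.indicator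
    (fun p => Complex.exp (Complex.I * s * p.1) / ((p.1 ^ 2 + ‖p.2‖ ^ 2 + a ^ 2 : ℝ) : ℂ)) p

lemma cylFun_integrable (a s R : ℝ) (ha : 0 < a) : Integrable (cylFun a s R) := by
  have hS : MeasurableSet {p : ℝ × ℂ | p.1 ^ 2 + ‖p.2‖ ^ 2 < R ^ 2} :=
    (isOpen_lt (by fun_prop) (by fun_prop)).measurableSet
  unfold cylFun
  refine IntegrableOn.integrable_indicator ?_ hS
  refine Measure.integrableOn_of_bounded (M := (a ^ 2)⁻¹) ?_ ?_ ?_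
  · refine (lt_of_le_of_lt (measure_mono (t := Metric.closedBall 0 |R|) ?_)
      measure_closedBall_lt_top).ne
    rintro ⟨t, z⟩ h
    simp only [Set.mem_ofPred_eq] at h
    rw [mem_closedBall_zero_iff, Prod.norm_def, max_le_iff]
    refine ⟨sq_le_sq.1 (by nlinarith [sq_nonneg ‖z‖]), ?_⟩
    exact (le_abs_self _).trans (sq_le_sq.1 (by nlinarith [sq_nonneg t]))
  · refine Continuous.aestronglyMeasurable ?_
    refine Continuous.div (by fun_prop) (by fun_prop) (fun p => ?_)
    have : p.1 ^ 2 + ‖p.2‖ ^ 2 + a ^ 2 ≠ 0 := by positivity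
    exact_mod_cast this
  · refine ae_of_all _ fun p => ?_
    rw [norm_div, Complex.norm_exp, Complex.norm_real, Real.norm_of_nonneg (by positivity)]
    have : (Complex.I * s * p.1).re = 0 := by simp
    rw [this, Real.exp_zero, one_div]
    gcongr
    nlinarith [sq_nonneg p.1, sq_nonneg ‖p.2‖]

lemma cylFun_inner (a s R : ℝ) (ha : 0 < a) (hR : 0 < R) (t : ℝ) :
    ∫ z : ℂ, cylFun a s R (t, z) = (Set.Ioc (-R) R).indicator (fun t : ℝ => (π : ℂ) *
      (((Real.log (R ^ 2 + a ^ 2) - Real.log (t ^ 2 + a ^ 2) : ℝ) : ℂ)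
      * Complex.exp (Complex.I * s * t))) t := by
  have hp : ∀ y : ℝ, t ^ 2 + y ^ 2 + a ^ 2 ≠ 0 := fun y => by positivity
  have h := integral_fun_norm_addHaar (volume : Measure ℂ) (fun y : ℝ =>
    {y : ℝ | t ^ 2 + y ^ 2 < R ^ 2}.indicator
      (fun y => ((1 / (t ^ 2 + y ^ 2 + a ^ 2) : ℝ))) y)
  have hcyl : ∀ z : ℂ, cylFun a s R (t, z) = Complex.exp (Complex.I * s * t) *
      (({y : ℝ | t ^ 2 + y ^ 2 < R ^ 2}.indicator
      (fun y => ((1 / (t ^ 2 + y ^ 2 + a ^ 2) : ℝ))) ‖z‖ : ℝ) : ℂ) := by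
    intro z
    simp only [cylFun, Set.indicator_apply, Set.mem_ofPred_eq]
    split_ifs
    · push_cast; ring
    · simp
  simp only [hcyl]
  rw [integral_const_mul, integral_complex_ofReal, h]
  have hball : (volume : Measure ℂ).real (Metric.ball 0 1) = π := by
    simp [Measure.real, Complex.volume_ball]
  rw [hball, Complex.finrank_real_complex]
  have hI : ∫ y in Set.Ioi (0:ℝ), y ^ (2 - 1) • {y : ℝ | t ^ 2 + y ^ 2 < R ^ 2}.indicator
      (fun y => ((1 / (t ^ 2 + y ^ 2 + a ^ 2) : ℝ))) y = (Set.Ioc (-R) R).indicator (fun t : ℝ =>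
      (1 / 2 : ℝ) * (Real.log (R ^ 2 + a ^ 2) - Real.log (t ^ 2 + a ^ 2))) t := by
    by_cases ht : t ^ 2 < R ^ 2
    · have htm : t ∈ Set.Ioc (-R) R := by
        have := abs_lt_of_sq_lt_sq' ht hR.le
        exact ⟨this.1, this.2.le⟩
      rw [Set.indicator_of_mem htm]
      set ρ := √(R ^ 2 - t ^ 2) with hρ
      have hρ0 : 0 < ρ := Real.sqrt_pos.2 (by linarith)
      have hρ2 : ρ ^ 2 = R ^ 2 - t ^ 2 := Real.sq_sqrt (by linarith)
      have e1 : ∫ y in Set.Ioi (0:ℝ), y ^ (2 - 1) • {y : ℝ | t ^ 2 + y ^ 2 < R ^ 2}.indicator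
        (fun y => ((1 / (t ^ 2 + y ^ 2 + a ^ 2) : ℝ))) y =
          ∫ y in Set.Ioi (0:ℝ), (Set.Ioo 0 ρ).indicator
          (fun y => y / (t ^ 2 + y ^ 2 + a ^ 2)) y := by
        refine setIntegral_congr_fun measurableSet_Ioi fun y hy => ?_
        have hy : 0 < y := hy
        have : t ^ 2 + y ^ 2 < R ^ 2 ↔ y < ρ := by
          rw [← pow_lt_pow_iff_left₀ hy.le hρ0.le two_ne_zero, hρ2]
          constructor <;> intro h <;> linarith
        simp only [Set.indicator_apply, Set.mem_ofPred_eq, Set.mem_Ioo, this, hy, true_and]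
        split_ifs
        · simp; ring
        · simp
      rw [e1, setIntegral_indicator measurableSet_Ioo, Set.inter_eq_right.2
        (fun y hy => hy.1), ← integral_Ioc_eq_integral_Ioo,
        ← intervalIntegral.integral_of_le hρ0.le]
      have hd : ∀ y ∈ Set.uIcc 0 ρ, HasDerivAt
          (fun y : ℝ => (1 / 2 : ℝ) * Real.log (t ^ 2 + y ^ 2 + a ^ 2))
          (y / (t ^ 2 + y ^ 2 + a ^ 2)) y := by
        intro y _
        have h1 := ((((hasDerivAt_pow 2 y).const_add (t ^ 2)).add_const (a ^ 2)).log
          (hp y)).const_mul (1 / 2 : ℝ)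
        refine h1.congr_deriv ?_
        simp; ring
      rw [intervalIntegral.integral_eq_sub_of_hasDerivAt hd]
      · rw [hρ2]; ring_nf
      · refine Continuous.intervalIntegrable ?_ _ _
        exact Continuous.div (by fun_prop) (by fun_prop) hp
    · have e0 : ∀ y : ℝ, {y : ℝ | t ^ 2 + y ^ 2 < R ^ 2}.indicator
        (fun y => ((1 / (t ^ 2 + y ^ 2 + a ^ 2) : ℝ))) y = 0 := by
        intro y
        refine Set.indicator_of_notMem ?_ _
        simp only [Set.mem_ofPred_eq, not_lt]
        nlinarith [sq_nonneg y]
      simp only [e0, smul_zero, integral_zero]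
      simp only [Set.indicator_apply]
      split_ifs with hm
      · have : t ^ 2 = R ^ 2 := le_antisymm (sq_le_sq' hm.1.le hm.2) (not_lt.1 ht)
        rw [this]; simp
      · rfl
  rw [hI]
  simp only [Set.indicator_apply]
  split_ifs
  · simp only [smul_eq_mul, nsmul_eq_mul]; push_cast; ring
  · simp

lemma exists_coords (x : EuclideanSpace ℝ (Fin 3)) (hx : x ≠ 0) :
    ∃ e : EuclideanSpace ℝ (Fin 3) ≃ᵐ ℝ × ℂ, MeasurePreserving e volume volume ∧
      (∀ k, ⟪k, x⟫ = ‖x‖ * (e k).1) ∧ ∀ k, ‖k‖ ^ 2 = (e k).1 ^ 2 + ‖(e k).2‖ ^ 2 := by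
  have hx0 : ‖x‖ ≠ 0 := norm_ne_zero_iff.2 hx
  obtain ⟨b, hb⟩ := Orthonormal.exists_orthonormalBasis_extension_of_card_eq (𝕜 := ℝ)
    (E := EuclideanSpace ℝ (Fin 3)) (ι := Fin 3) (by simp) (v := fun _ => ‖x‖⁻¹ • x)
    (s := {0}) (by
      constructor
      · rintro ⟨i, hi⟩
        simp [Set.domRestrict, norm_smul, hx0]
      · rintro ⟨i, hi⟩ ⟨j, hj⟩ hij
        exact absurd (Subtype.ext (hi.trans hj.symm)) hij)
  have hb0 := hb 0 rfl
  let e1 : EuclideanSpace ℝ (Fin 3) ≃ᵐ EuclideanSpace ℝ (Fin 3) := b.measurableEquiv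
  let e2 := (MeasurableEquiv.toLp 2 (Fin 3 → ℝ)).symm
  let e3 := MeasurableEquiv.piFinSuccAbove (fun _ : Fin 3 => ℝ) 0
  let e4 : ℝ × (Fin 2 → ℝ) ≃ᵐ ℝ × ℂ :=
    (MeasurableEquiv.refl ℝ).prodCongr Complex.measurableEquivPi.symm
  refine ⟨((e1.trans e2).trans e3).trans e4, ?_, ?_, ?_⟩
  · have h1 : MeasurePreserving e1 volume volume := b.measurePreserving_repr
    have h2 : MeasurePreserving e2 volume volume :=
      EuclideanSpace.volume_preserving_symm_measurableEquiv_toLp _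
    have h3 : MeasurePreserving e3 volume volume := volume_preserving_piFinSuccAbove _ 0
    have h4 : MeasurePreserving e4 volume volume :=
      (MeasurePreserving.id volume).prod
        (Complex.volume_preserving_equiv_pi.symm Complex.measurableEquivPi)
    exact h4.comp (h3.comp (h2.comp h1))
  · intro k
    have : ((((e1.trans e2).trans e3).trans e4) k).1 = b.repr k 0 := rfl
    rw [this, b.repr_apply_apply, hb0, inner_smul_left, real_inner_comm]
    simp; field_simp
  · intro k
    have h1 : ((((e1.trans e2).trans e3).trans e4) k).1 = b.repr k 0 := rfl
    have h2 : ((((e1.trans e2).trans e3).trans e4) k).2 =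
      Complex.mk (b.repr k 1) (b.repr k 2) := by
        have h3 : ((((e1.trans e2).trans e3).trans e4) k).2 = Complex.measurableEquivPi.symm
          (fun i : Fin 2 => b.repr k (Fin.succ i)) := rfl
        rw [h3, Complex.measurableEquivPi_symm_apply, ← Complex.mk_eq_add_mul_I]
        rfl
    rw [h1, h2, ← b.repr.norm_map k, EuclideanSpace.norm_sq_eq, ← Complex.normSq_eq_norm_sq,
      Complex.normSq_mk]
    simp [Fin.sum_univ_three]; ring

theorem ball_integral_eq (a : ℝ) (ha : 0 < a) (x : EuclideanSpace ℝ (Fin 3)) (hx : x ≠ 0) (R : ℝ) (hR : 0 < R) :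
        ∫ k in Metric.ball (0 : EuclideanSpace ℝ (Fin 3)) R,
          Complex.exp (Complex.I * (⟪k, x⟫ : ℝ)) / ((‖k‖ ^ 2 + a ^ 2 : ℝ) : ℂ) =
        (π : ℂ) * ∫ t in (-R)..R, ((Real.log (R ^ 2 + a ^ 2) - Real.log (t ^ 2 + a ^ 2) : ℝ) : ℂ)
      * Complex.exp (Complex.I * ‖x‖ * t) := by
  obtain ⟨e, he, he1, he2⟩ := exists_coords x hx
  rw [← integral_indicator measurableSet_ball]
  have h1 : ∀ k, (Metric.ball (0 : EuclideanSpace ℝ (Fin 3)) R).indicator (fun k =>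
      Complex.exp (Complex.I * (⟪k, x⟫ : ℝ)) / ((‖k‖ ^ 2 + a ^ 2 : ℝ) : ℂ)) k
      = cylFun a ‖x‖ R (e k) := by
    intro k
    have hm : k ∈ Metric.ball (0 : EuclideanSpace ℝ (Fin 3)) R ↔
        e k ∈ {p : ℝ × ℂ | p.1 ^ 2 + ‖p.2‖ ^ 2 < R ^ 2} := by
      rw [Set.mem_ofPred_eq, mem_ball_zero_iff, ← he2, pow_lt_pow_iff_left₀ (norm_nonneg _) hR.le two_ne_zero]
    by_cases hk : k ∈ Metric.ball (0 : EuclideanSpace ℝ (Fin 3)) R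
    · rw [cylFun, Set.indicator_of_mem hk, Set.indicator_of_mem (hm.1 hk), he1, he2]
      push_cast
      simp only [mul_assoc]
    · rw [cylFun, Set.indicator_of_notMem hk, Set.indicator_of_notMem (fun h => hk (hm.2 h))]
  simp only [h1]
  rw [he.integral_comp' (cylFun a ‖x‖ R), Measure.volume_eq_prod,
    integral_prod _ (cylFun_integrable a ‖x‖ R ha)]
  simp only [cylFun_inner a ‖x‖ R ha hR]
  rw [integral_indicator measurableSet_Ioc, intervalIntegral.integral_of_le (by linarith),
    integral_const_mul]

/-- Fourier transform of the Yukawa potential in ℝ³, as an improper integral over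
expanding balls: `∫ e^{ik·x}/(|k|²+a²) dk = (2π²/|x|) e^{-a|x|}`. -/
theorem fourier_yukawa (a : ℝ) (ha : 0 < a) (x : EuclideanSpace ℝ (Fin 3)) (hx : x ≠ 0) :
    Tendsto (fun R : ℝ =>
        ∫ k in Metric.ball (0 : EuclideanSpace ℝ (Fin 3)) R,
          Complex.exp (Complex.I * (⟪k, x⟫ : ℝ)) / ((‖k‖ ^ 2 + a ^ 2 : ℝ) : ℂ))
      atTop
      (𝓝 (((2 * π ^ 2 / ‖x‖) * Real.exp (-a * ‖x‖) : ℝ) : ℂ)) := by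
  have h := (limit_aux a ‖x‖ ha (norm_pos_iff.2 hx)).const_mul (π : ℂ)
  have hl : (π : ℂ) * ((2 * π / ‖x‖ * Real.exp (-a * ‖x‖) : ℝ) : ℂ) =
      (((2 * π ^ 2 / ‖x‖) * Real.exp (-a * ‖x‖) : ℝ) : ℂ) := by
    push_cast; ring
  rw [hl] at h
  refine h.congr' ?_
  filter_upwards [eventually_gt_atTop 0] with R hR
  exact (ball_integral_eq a ha x hx R hR).symm
end

section
/- For every real p, every nonnegative integer ℓ, and every x ∈ [0,1], ₂F₁((ℓ+1+ip)/2, (ℓ+1−ip)/2; ℓ+3/2; x²) ≤ (((ℓ/2)!)² / |Γ((ℓ+2+ip)/2)|²) · ₂F₁((ℓ+1)/2, (ℓ+1)/2; ℓ+3/2; x²), where ℓ is assumed even so that (ℓ/2)! makes sense. -/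
open Real Complex

/-- The Gauss hypergeometric function `₂F₁(a,b;c;z)` as a series. -/
noncomputable def hyp2F1 (a b c z : ℂ) : ℂ :=
  ∑' k : ℕ,
    Polynomial.eval a (ascPochhammer ℂ k) * Polynomial.eval b (ascPochhammer ℂ k) /
      (Polynomial.eval c (ascPochhammer ℂ k) * (Nat.factorial k : ℂ)) * z ^ k

/-- Coefficients of `₂F₁(α+iq, α-iq; c; z)`. -/
noncomputable def hcf (α q c : ℝ) : ℕ → ℝ
  | 0 => 1
  | n + 1 => hcf α q c n * (((α + n) ^ 2 + q ^ 2) / ((c + n) * (n + 1)))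

/-- Coefficients of `(1-z)^{-1/2}`. -/
noncomputable def tcf : ℕ → ℝ
  | 0 => 1
  | n + 1 => tcf n * ((n + 1 / 2) / (n + 1))

lemma hcf_nonneg {α q c : ℝ} (hc : 0 < c) (n : ℕ) : 0 ≤ hcf α q c n := by
  induction n with
  | zero => simp [hcf]
  | succ n ih => rw [hcf]; positivity

lemma tcf_nonneg (n : ℕ) : 0 ≤ tcf n := by
  induction n with
  | zero => simp [tcf]
  | succ n ih => rw [tcf]; positivity

lemma tcf_le_one (n : ℕ) : tcf n ≤ 1 := by
  induction n with
  | zero => simp [tcf]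
  | succ n ih =>
    rw [tcf]
    have h : ((n : ℝ) + 1 / 2) / (n + 1) ≤ 1 := by
      rw [div_le_one (by positivity)]; linarith
    exact mul_le_one₀ ih (by positivity) h

lemma hcf_summable {α q : ℝ} (hα : 0 ≤ α) : Summable (hcf α q (2 * α + 1 / 2)) := by
  obtain ⟨N, hN⟩ := exists_nat_ge (4 * (α ^ 2 + q ^ 2) + (2 * α + 1 / 2))
  have hc : 0 < 2 * α + 1 / 2 := by linarith
  rw [← summable_nat_add_iff N]
  refine summable_of_sum_range_le (c := 4 * (N * hcf α q (2 * α + 1 / 2) N))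
    (fun n => hcf_nonneg hc _) ?_
  intro n
  have key : ∑ i ∈ Finset.range n, hcf α q (2 * α + 1 / 2) (i + N) ≤
      4 * (N * hcf α q (2 * α + 1 / 2) N)
        - 4 * (((n + N : ℕ) : ℝ) * hcf α q (2 * α + 1 / 2) (n + N)) := by
    induction n with
    | zero => simp
    | succ n ih =>
      rw [Finset.sum_range_succ]
      have h1 : ((n + 1 + N : ℕ) : ℝ) * hcf α q (2 * α + 1 / 2) (n + 1 + N) =
          hcf α q (2 * α + 1 / 2) (n + N) *
            (((α + (n + N : ℕ)) ^ 2 + q ^ 2) / (2 * α + 1 / 2 + (n + N : ℕ))) := by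
        rw [show n + 1 + N = (n + N) + 1 by ring, hcf]
        push_cast
        have : (n : ℝ) + N + 1 ≠ 0 := by positivity
        have : 2 * α + 1 / 2 + ((n : ℝ) + N) ≠ 0 := by positivity
        field_simp
      rw [h1]
      have h0 := hcf_nonneg (α := α) (q := q) hc (n + N)
      have hM : (4 * (α ^ 2 + q ^ 2) + (2 * α + 1 / 2)) ≤ ((n + N : ℕ) : ℝ) := by
        push_cast; have : (0 : ℝ) ≤ n := by positivity
        linarith
      generalize ((n + N : ℕ) : ℝ) = M at *
      have hMpos : 0 ≤ M := by nlinarith [sq_nonneg α, sq_nonneg q]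
      have h2 : ((α + M) ^ 2 + q ^ 2) / (2 * α + 1 / 2 + M) ≤ M - 1 / 4 := by
        rw [div_le_iff₀ (by linarith)]
        nlinarith
      have := mul_le_mul_of_nonneg_left h2 h0
      linarith
  have : 0 ≤ 4 * (((n + N : ℕ) : ℝ) * hcf α q (2 * α + 1 / 2) (n + N)) := by
    have := hcf_nonneg (α := α) (q := q) hc (n + N)
    positivity
  linarith

open PowerSeries in
lemma ode_iff (A B c : ℝ) (F : PowerSeries ℝ) :
    (X * (1 - X) * derivative ℝ (derivative ℝ F) + (C c - C (A + 1) * X) * derivative ℝ F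
      - C B * F = 0) ↔
    ∀ n : ℕ, coeff (n + 1) F * ((c + n) * (n + 1)) = coeff n F * ((n : ℝ) ^ 2 + A * n + B) := by
  have e : X * (1 - X) * derivative ℝ (derivative ℝ F) + (C c - C (A + 1) * X) * derivative ℝ F
      - C B * F = X * derivative ℝ (derivative ℝ F) - X * (X * derivative ℝ (derivative ℝ F))
       + C c * derivative ℝ F - C (A + 1) * (X * derivative ℝ F) - C B * F := by ring
  rw [e, PowerSeries.ext_iff]
  clear e
  obtain ⟨D, rfl⟩ : ∃ D, A = D - 1 := ⟨A + 1, by ring⟩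
  rw [sub_add_cancel]
  refine forall_congr' fun n => ?_
  rcases n with _ | _ | n
  · simp only [map_sub, map_add, coeff_C_mul, coeff_zero_X_mul, coeff_derivative, map_zero]
    push_cast
    constructor <;> intro h <;> linarith
  · simp only [map_sub, map_add, coeff_C_mul, coeff_succ_X_mul, coeff_zero_X_mul, coeff_derivative,
      map_zero]
    push_cast
    constructor <;> intro h <;> linarith
  · simp only [map_sub, map_add, coeff_C_mul, coeff_succ_X_mul, coeff_derivative, map_zero]
    push_cast
    constructor <;> intro h <;> linarith

open PowerSeries in
lemma tcf_ode : (1 - X) * derivative ℝ (PowerSeries.mk tcf) =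
    C (1 / 2 : ℝ) * PowerSeries.mk tcf := by
  rw [sub_mul, one_mul]
  ext n
  have h : tcf (n + 1) * (n + 1) = tcf n * (n + 1 / 2) := by
    rw [tcf]; field_simp
  rcases n with _ | n
  · simp only [map_sub, coeff_C_mul, coeff_zero_X_mul, coeff_derivative, coeff_mk]
    push_cast at *
    linarith
  · simp only [map_sub, coeff_C_mul, coeff_succ_X_mul, coeff_derivative, coeff_mk]
    push_cast at *
    linarith

lemma hcf_rec {α q c : ℝ} (hc : 0 < c) (n : ℕ) :
    hcf α q c (n + 1) * ((c + n) * (n + 1)) =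
      hcf α q c n * ((n : ℝ) ^ 2 + (2 * α) * n + (α ^ 2 + q ^ 2)) := by
  rw [hcf]
  have : c + n ≠ 0 := by positivity
  field_simp
  ring

open PowerSeries in
lemma euler_ps {α q : ℝ} (hα : 0 ≤ α) :
    PowerSeries.mk tcf * PowerSeries.mk (hcf α q (2 * α + 1 / 2)) =
      PowerSeries.mk (hcf (α + 1 / 2) q (2 * α + 1 / 2)) := by
  have hc : 0 < 2 * α + 1 / 2 := by linarith
  have hF := (ode_iff (2 * α) (α ^ 2 + q ^ 2) (2 * α + 1 / 2)
    (PowerSeries.mk (hcf α q (2 * α + 1 / 2)))).2 (by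
      intro n; simp only [coeff_mk]; exact hcf_rec hc n)
  have hT := tcf_ode
  have hT0 : coeff 0 (PowerSeries.mk tcf) = 1 := by simp [tcf]
  have hF0 : coeff 0 (PowerSeries.mk (hcf α q (2 * α + 1 / 2))) = 1 := by simp [hcf]
  generalize PowerSeries.mk tcf = T at *
  generalize PowerSeries.mk (hcf α q (2 * α + 1 / 2)) = F at *
  have hT2 := congrArg (derivative ℝ) hT
  simp only [Derivation.leibniz, map_sub, derivative_C, derivative_X, smul_eq_mul,
    Derivation.map_one_eq_zero] at hT2
  have hG := (ode_iff (2 * (α + 1 / 2)) ((α + 1 / 2) ^ 2 + q ^ 2) (2 * α + 1 / 2) (T * F)).1 (by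
    have e0 : (C (2 : ℝ) : PowerSeries ℝ) = 2 := map_ofNat _ 2
    have e1 : (C (2 * (α + 1 / 2) + 1) : PowerSeries ℝ) = 2 * C α + 2 := by
      rw [show 2 * (α + 1 / 2) + 1 = 2 * α + 2 by ring, map_add, map_mul, e0]
    have e2 : (C (2 * α + 1) : PowerSeries ℝ) = 2 * C α + 1 := by
      rw [map_add, map_mul, e0, map_one]
    have e3 : (C (2 * α + 1 / 2) : PowerSeries ℝ) = 2 * C α + C (1 / 2) := by
      rw [map_add, map_mul, e0]
    have e4 : (C ((α + 1 / 2) ^ 2 + q ^ 2) : PowerSeries ℝ) =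
        C (α ^ 2 + q ^ 2) + C (1 / 2) * (2 * C α + C (1 / 2)) := by
      rw [← e3, ← map_mul, ← map_add]; congr 1; ring
    have e5 : (2 : PowerSeries ℝ) * C (1 / 2 : ℝ) = 1 := by
      rw [← e0, ← map_mul]; norm_num
    rw [e2, e3] at hF
    rw [e1, e3, e4]
    generalize (C (1 / 2) : PowerSeries ℝ) = h at *
    generalize (C (α ^ 2 + q ^ 2) : PowerSeries ℝ) = B at *
    simp only [Derivation.leibniz, map_add, smul_eq_mul]
    linear_combination T * hF + X * F * hT2 + (2 * X * derivative ℝ F + (2 * C α + h) * F) * hT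
      + (X * derivative ℝ F * T + X * F * derivative ℝ T) * e5)
  ext n
  induction n with
  | zero =>
    simp only [coeff_mk, hcf]
    rw [coeff_zero_eq_constantCoeff_apply] at *
    rw [map_mul, hT0, hF0, one_mul]
  | succ n ih =>
    have h1 := hG n
    rw [coeff_mk] at *
    have h2 := hcf_rec (α := α + 1 / 2) (q := q) hc n
    rw [ih, ← h2] at h1
    have : 0 < (2 * α + 1 / 2 + n) * ((n : ℝ) + 1) := by positivity
    exact mul_right_cancel₀ this.ne' h1

lemma norm_Gamma_le (s : ℂ) (hs : 0 < s.re) : ‖Complex.Gamma s‖ ≤ Real.Gamma s.re := by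
  rw [Complex.Gamma_eq_integral hs, Complex.GammaIntegral, Real.Gamma_eq_integral hs]
  refine (MeasureTheory.norm_integral_le_integral_norm _).trans (le_of_eq ?_)
  refine MeasureTheory.setIntegral_congr_fun measurableSet_Ioi fun x hx => ?_
  simp only [norm_mul, Complex.norm_real, Real.norm_eq_abs, abs_of_pos (Real.exp_pos _)]
  rw [Complex.norm_cpow_eq_rpow_re_of_pos hx]
  simp

lemma hcf_gamma (m : ℕ) (q c : ℝ) (hc : 0 < c) (n : ℕ) :
    hcf (m + 1) q c n * ‖Complex.Gamma ((m : ℂ) + 1 + q * Complex.I)‖ ^ 2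
        * ((m + n).factorial : ℝ) ^ 2 =
      ‖Complex.Gamma ((m : ℂ) + 1 + n + q * Complex.I)‖ ^ 2 * hcf (m + 1) 0 c n
        * (m.factorial : ℝ) ^ 2 := by
  induction n with
  | zero => simp [hcf]
  | succ n ih =>
    have hs : ((m : ℂ) + 1 + n + q * Complex.I) ≠ 0 := by
      intro h
      have := congrArg Complex.re h
      simp at this
      have h2 : (0 : ℝ) < (m : ℝ) + 1 + n := by positivity
      linarith
    have e : ((m : ℂ) + 1 + (n + 1 : ℕ) + q * Complex.I) =
        ((m : ℂ) + 1 + n + q * Complex.I) + 1 := by push_cast; ring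
    rw [e, Complex.Gamma_add_one _ hs, norm_mul, mul_pow, hcf, hcf, ← add_assoc,
      Nat.factorial_succ]
    have hn : ‖(m : ℂ) + 1 + n + q * Complex.I‖ ^ 2 = ((m : ℝ) + 1 + n) ^ 2 + q ^ 2 := by
      rw [← Complex.normSq_eq_norm_sq, Complex.normSq_apply]; simp; ring
    rw [hn]
    push_cast
    linear_combination ((m : ℝ) + 1 + n) ^ 2 * (((m : ℝ) + 1 + n) ^ 2 + q ^ 2) /
      ((c + n) * (n + 1)) * ih

lemma hcf_le (m : ℕ) (q c : ℝ) (hc : 0 < c) (n : ℕ) :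
    hcf (m + 1) q c n ≤ (m.factorial : ℝ) ^ 2 /
      ‖Complex.Gamma ((m : ℂ) + 1 + q * Complex.I)‖ ^ 2 * hcf (m + 1) 0 c n := by
  have h := hcf_gamma m q c hc n
  have hG : 0 < ‖Complex.Gamma ((m : ℂ) + 1 + q * Complex.I)‖ := by
    rw [norm_pos_iff]
    apply Complex.Gamma_ne_zero_of_re_pos
    simp; positivity
  have hle : ‖Complex.Gamma ((m : ℂ) + 1 + n + q * Complex.I)‖ ≤ ((m + n).factorial : ℝ) := by
    have h1 : ((m : ℂ) + 1 + n + q * Complex.I).re = ((m + n : ℕ) : ℝ) + 1 := by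
      simp; ring
    have := norm_Gamma_le ((m : ℂ) + 1 + n + q * Complex.I) (by rw [h1]; positivity)
    rwa [h1, Real.Gamma_nat_eq_factorial] at this
  have hf : (0 : ℝ) < ((m + n).factorial : ℝ) := by positivity
  have h0 := hcf_nonneg (α := (m : ℝ) + 1) (q := 0) hc n
  rw [div_mul_eq_mul_div, le_div_iff₀ (by positivity)]
  refine le_of_mul_le_mul_right (a := ((m + n).factorial : ℝ) ^ 2) ?_ (by positivity)
  rw [h]
  have : ‖Complex.Gamma ((m : ℂ) + 1 + n + q * Complex.I)‖ ^ 2 ≤ ((m + n).factorial : ℝ) ^ 2 := by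
    gcongr
  calc _ ≤ ((m + n).factorial : ℝ) ^ 2 * hcf (m + 1) 0 c n * (m.factorial : ℝ) ^ 2 := by gcongr
    _ = _ := by ring

lemma hcf_summable_pow {α q z : ℝ} (hα : 0 ≤ α) (hz : 0 ≤ z) (hz1 : z ≤ 1) :
    Summable (fun k => hcf α q (2 * α + 1 / 2) k * z ^ k) := by
  have hc : 0 < 2 * α + 1 / 2 := by linarith
  refine Summable.of_nonneg_of_le (fun k => mul_nonneg (hcf_nonneg hc k) (by positivity))
    (fun k => ?_) (hcf_summable (q := q) hα)
  exact mul_le_of_le_one_right (hcf_nonneg hc k) (pow_le_one₀ hz hz1)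

lemma tcf_summable {z : ℝ} (hz : 0 ≤ z) (hz1 : z < 1) : Summable (fun k => tcf k * z ^ k) := by
  refine Summable.of_nonneg_of_le (fun k => mul_nonneg (tcf_nonneg k) (by positivity))
    (fun k => ?_) (summable_geometric_of_lt_one hz hz1)
  exact mul_le_of_le_one_left (by positivity) (tcf_le_one k)

lemma euler_sum {α q z : ℝ} (hα : 0 ≤ α) (hz : 0 ≤ z) (hz1 : z < 1) :
    HasSum (fun k => hcf (α + 1 / 2) q (2 * α + 1 / 2) k * z ^ k)
      ((∑' k, tcf k * z ^ k) * ∑' k, hcf α q (2 * α + 1 / 2) k * z ^ k) := by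
  have h1 := (tcf_summable hz hz1).norm
  have h2 := (hcf_summable_pow (q := q) hα hz hz1.le).norm
  have e : (fun k => hcf (α + 1 / 2) q (2 * α + 1 / 2) k * z ^ k) = fun n =>
      ∑ kl ∈ Finset.HasAntidiagonal.antidiagonal n, (tcf kl.1 * z ^ kl.1) *
        (hcf α q (2 * α + 1 / 2) kl.2 * z ^ kl.2) := by
    ext n
    have := congrArg (PowerSeries.coeff n) (euler_ps (q := q) hα)
    rw [PowerSeries.coeff_mul, PowerSeries.coeff_mk] at this
    rw [← this, Finset.sum_mul]
    refine Finset.sum_congr rfl fun kl hkl => ?_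
    rw [Finset.HasAntidiagonal.mem_antidiagonal] at hkl
    simp only [PowerSeries.coeff_mk]
    rw [← hkl, pow_add]
    ring
  rw [tsum_mul_tsum_eq_tsum_sum_antidiagonal_of_summable_norm h1 h2, e]
  exact (summable_norm_sum_mul_antidiagonal_of_summable_norm h1 h2).of_norm.hasSum

lemma main_lt (m : ℕ) (q : ℝ) {z : ℝ} (hz : 0 ≤ z) (hz1 : z < 1) :
    ∑' k, hcf (m + 1 / 2) q (2 * (m + 1 / 2) + 1 / 2) k * z ^ k ≤
      (m.factorial : ℝ) ^ 2 / ‖Complex.Gamma ((m : ℂ) + 1 + q * Complex.I)‖ ^ 2 *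
        ∑' k, hcf (m + 1 / 2) 0 (2 * (m + 1 / 2) + 1 / 2) k * z ^ k := by
  have hα : (0 : ℝ) ≤ m + 1 / 2 := by positivity
  have h1 := euler_sum (q := q) hα hz hz1
  have h2 := (euler_sum (q := 0) hα hz hz1).mul_left
    ((m.factorial : ℝ) ^ 2 / ‖Complex.Gamma ((m : ℂ) + 1 + q * Complex.I)‖ ^ 2)
  have ha : (m : ℝ) + 1 / 2 + 1 / 2 = m + 1 := by ring
  rw [ha] at h1 h2
  have h3 := hasSum_le (fun n => by
    rw [← mul_assoc]
    exact mul_le_mul_of_nonneg_right (hcf_le m q (2 * (m + 1 / 2) + 1 / 2) (by positivity) n)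
      (by positivity)) h1 h2
  have hT : 0 < ∑' k, tcf k * z ^ k :=
    (tcf_summable hz hz1).tsum_pos (fun k => mul_nonneg (tcf_nonneg k) (by positivity)) 0
      (by simp [tcf])
  refine le_of_mul_le_mul_left (h3.trans (le_of_eq ?_)) hT
  ring

lemma main_le (m : ℕ) (q : ℝ) {z : ℝ} (hz : 0 ≤ z) (hz1 : z ≤ 1) :
    ∑' k, hcf (m + 1 / 2) q (2 * (m + 1 / 2) + 1 / 2) k * z ^ k ≤
      (m.factorial : ℝ) ^ 2 / ‖Complex.Gamma ((m : ℂ) + 1 + q * Complex.I)‖ ^ 2 *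
        ∑' k, hcf (m + 1 / 2) 0 (2 * (m + 1 / 2) + 1 / 2) k * z ^ k := by
  rcases hz1.lt_or_eq with h | rfl
  · exact main_lt m q hz h
  have hα : (0 : ℝ) ≤ m + 1 / 2 := by positivity
  have hc : (0 : ℝ) < 2 * (m + 1 / 2) + 1 / 2 := by positivity
  refine Real.tsum_le_of_sum_range_le (fun n => mul_nonneg (hcf_nonneg hc n) (by positivity)) ?_
  intro n
  have hcont : Continuous (fun z : ℝ => ∑ k ∈ Finset.range n,
      hcf (m + 1 / 2) q (2 * (m + 1 / 2) + 1 / 2) k * z ^ k) := by fun_prop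
  have ht := (hcont.tendsto 1).mono_left (nhdsWithin_le_nhds (s := Set.Iio 1))
  refine le_of_tendsto ht ?_
  filter_upwards [Ioo_mem_nhdsLT (zero_lt_one (α := ℝ))] with z hz
  have s1 := hcf_summable_pow (q := q) hα hz.1.le hz.2.le
  have s2 := hcf_summable_pow (q := 0) hα hz.1.le hz.2.le
  have s3 := hcf_summable_pow (q := 0) hα zero_le_one le_rfl
  refine (s1.sum_le_tsum _ (fun k _ => mul_nonneg (hcf_nonneg hc k)
    (pow_nonneg hz.1.le k))).trans ((main_lt m q hz.1.le hz.2).trans ?_)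
  refine mul_le_mul_of_nonneg_left (s2.tsum_le_tsum (fun k => ?_) s3) (by positivity)
  refine mul_le_mul_of_nonneg_left ?_ (hcf_nonneg hc k)
  rw [one_pow]
  exact pow_le_one₀ hz.1.le hz.2.le

lemma hyp_eq (α q c z : ℝ) (hc : 0 < c) (a b cc zz : ℂ) (ha : a = α + q * Complex.I)
    (hb : b = α - q * Complex.I) (hcc : cc = c) (hz : zz = z) :
    hyp2F1 a b cc zz = ((∑' k, hcf α q c k * z ^ k : ℝ) : ℂ) := by
  rw [hyp2F1, Complex.ofReal_tsum]
  refine tsum_congr fun k => ?_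
  rw [hz, Complex.ofReal_mul, Complex.ofReal_pow]
  congr 1
  induction k with
  | zero => simp [hcf]
  | succ k ih =>
    rw [hcf, Complex.ofReal_mul, ← ih, ascPochhammer_succ_eval, ascPochhammer_succ_eval,
      ascPochhammer_succ_eval, Nat.factorial_succ]
    have e : (a + k) * (b + k) = ((α : ℂ) + k) ^ 2 + q ^ 2 := by
      rw [ha, hb]; linear_combination (-(q : ℂ) ^ 2) * Complex.I_sq
    push_cast
    rw [← e, hcc, div_mul_div_comm]
    congr 1 <;> ring

/-- For `ℓ` even, `p ∈ ℝ` and `x ∈ [0,1]`, the hypergeometric value with conjugate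
parameters is real and
`₂F₁((ℓ+1+ip)/2,(ℓ+1-ip)/2;ℓ+3/2;x²)
  ≤ (((ℓ/2)!)²/|Γ((ℓ+2+ip)/2)|²) ₂F₁((ℓ+1)/2,(ℓ+1)/2;ℓ+3/2;x²)`. -/
theorem hyp2F1_conj_param_bound (l : ℕ) (hl : Even l) (p : ℝ) (x : ℝ)
    (hx : x ∈ Set.Icc (0 : ℝ) 1) :
    (hyp2F1 (((l : ℂ) + 1 + (p : ℂ) * Complex.I) / 2)
        (((l : ℂ) + 1 - (p : ℂ) * Complex.I) / 2) ((l : ℂ) + 3 / 2) ((x : ℂ) ^ 2)).im = 0 ∧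
    (hyp2F1 (((l : ℂ) + 1 + (p : ℂ) * Complex.I) / 2)
        (((l : ℂ) + 1 - (p : ℂ) * Complex.I) / 2) ((l : ℂ) + 3 / 2) ((x : ℂ) ^ 2)).re ≤
      (Nat.factorial (l / 2) : ℝ) ^ 2 /
          ‖Complex.Gamma (((l : ℂ) + 2 + (p : ℂ) * Complex.I) / 2)‖ ^ 2 *
        (hyp2F1 (((l : ℂ) + 1) / 2) (((l : ℂ) + 1) / 2) ((l : ℂ) + 3 / 2) ((x : ℂ) ^ 2)).re := by
  obtain ⟨m, rfl⟩ := hl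
  have hz : 0 ≤ x ^ 2 := by positivity
  have hz1 : x ^ 2 ≤ 1 := pow_le_one₀ hx.1 hx.2
  have hc : (0 : ℝ) < 2 * ((m : ℝ) + 1 / 2) + 1 / 2 := by positivity
  rw [hyp_eq (m + 1 / 2) (p / 2) (2 * ((m : ℝ) + 1 / 2) + 1 / 2) (x ^ 2) hc _ _ _ _
      (by push_cast; ring) (by push_cast; ring) (by push_cast; ring) (by push_cast; ring),
    hyp_eq (m + 1 / 2) 0 (2 * ((m : ℝ) + 1 / 2) + 1 / 2) (x ^ 2) hc _ _ _ _
      (by push_cast; ring) (by push_cast; ring) (by push_cast; ring) (by push_cast; ring),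
    Complex.ofReal_re, Complex.ofReal_re, Complex.ofReal_im]
  refine ⟨rfl, ?_⟩
  have h := main_le m (p / 2) hz hz1
  have e1 : (m + m) / 2 = m := by omega
  have e2 : (((m + m : ℕ) : ℂ) + 2 + (p : ℂ) * Complex.I) / 2 =
      (m : ℂ) + 1 + ((p / 2 : ℝ) : ℂ) * Complex.I := by push_cast; ring
  rw [e1, e2]
  exact h
end
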